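/- arXiv:2605.09432 — 8 statements merged into one kernel-verified Lean document; each statement's English description precedes it below -/
import Mathlib

section
/- Let E be a nonempty weakly connected demand set on a finite node set V, with sources S and destinations D. Then for every node K ∈ S ∪ D there exists a 2-hop solution for E of length |S \ {K}| + |D \ {K}| (first one flight from each source other than K to K, then one flight from K to each destination other than K). -/
/-- A demand `(i,j)` is served by schedule `L` along a path of length `ℓ ≥ 1`:
there are flights at increasing positions of `L` forming a path `i = w₀, w₁, …, w_ℓ = j`.
This is encoded by a node list `w` of length `ℓ + 1` whose list of consecutive pairs
is a sublist (ordered subsequence) of `L`. -/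
def ServesPath {V : Type*} (L : List (V × V)) (i j : V) (ℓ : ℕ) : Prop :=
  1 ≤ ℓ ∧ ∃ w : List V, w.length = ℓ + 1 ∧ w.head? = some i ∧ w.getLast? = some j ∧
    (w.zip w.tail).Sublist L

/-- `L` is a multihop solution for the demand set `E`: every demand is served
along a path of some length `ℓ ≥ 1`. -/
def IsMultihopSolution {V : Type*} (L : List (V × V)) (E : Finset (V × V)) : Prop :=
  ∀ p ∈ E, ∃ ℓ, ServesPath L p.1 p.2 ℓ

/-- `L` is a 2-hop solution for the demand set `E`: every demand is served
along a path of length at most 2. -/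
def IsTwoHopSolution {V : Type*} (L : List (V × V)) (E : Finset (V × V)) : Prop :=
  ∀ p ∈ E, ∃ ℓ ≤ 2, ServesPath L p.1 p.2 ℓ

/-- Node `v` is incident to some demand of `E`. -/
def Touches {V : Type*} (E : Finset (V × V)) (v : V) : Prop :=
  ∃ p ∈ E, p.1 = v ∨ p.2 = v

/-- `E` is weakly connected: in the undirected graph on the nodes incident to some
demand, with an edge `{u,v}` whenever `(u,v) ∈ E` or `(v,u) ∈ E`, every two incident
nodes are joined by a path. -/
def WeaklyConnected {V : Type*} (E : Finset (V × V)) : Prop :=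
  ∀ u v : V, Touches E u → Touches E v →
    Relation.ReflTransGen (fun a b => (a, b) ∈ E ∨ (b, a) ∈ E) u v

theorem ServesPath.of_mem {V : Type*} {L : List (V × V)} {i j : V} (h : (i, j) ∈ L) :
    ServesPath L i j 1 :=
  ⟨le_rfl, [i, j], rfl, rfl, rfl, by simpa using h⟩

theorem ServesPath.append_of_mem {V : Type*} {A B : List (V × V)} {i k j : V}
    (hA : (i, k) ∈ A) (hB : (k, j) ∈ B) : ServesPath (A ++ B) i j 2 :=
  ⟨one_le_two, [i, k, j], rfl, rfl, rfl,
    (List.singleton_sublist.2 hA).append (List.singleton_sublist.2 hB)⟩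

/-- For a nonempty weakly connected demand set `E` with sources `S` and destinations `D`,
every node `K ∈ S ∪ D` admits a 2-hop (coordinator) solution of length
`|S \ {K}| + |D \ {K}|`. -/
theorem coordinator_solution {V : Type*} [Fintype V] [DecidableEq V]
    (E : Finset (V × V)) (hE : ∀ p ∈ E, p.1 ≠ p.2)
    (hne : E.Nonempty) (hconn : WeaklyConnected E)
    (K : V) (hK : K ∈ E.image Prod.fst ∪ E.image Prod.snd) :
    ∃ L : List (V × V), IsTwoHopSolution L E ∧
      L.length = ((E.image Prod.fst).erase K).card + ((E.image Prod.snd).erase K).card := by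
  refine ⟨((E.image Prod.fst).erase K).toList.map (fun i => (i, K)) ++
    ((E.image Prod.snd).erase K).toList.map (fun j => (K, j)), ?_, by simp⟩
  rintro ⟨i, j⟩ hp
  have hij : i ≠ j := hE _ hp
  have hi : i ≠ K → (i, K) ∈ ((E.image Prod.fst).erase K).toList.map (fun i => (i, K)) :=
    fun h => List.mem_map_of_mem
      (Finset.mem_toList.2 (Finset.mem_erase.2 ⟨h, Finset.mem_image_of_mem Prod.fst hp⟩))
  have hj : j ≠ K → (K, j) ∈ ((E.image Prod.snd).erase K).toList.map (fun j => (K, j)) :=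
    fun h => List.mem_map_of_mem
      (Finset.mem_toList.2 (Finset.mem_erase.2 ⟨h, Finset.mem_image_of_mem Prod.snd hp⟩))
  by_cases hiK : i = K
  · subst hiK
    exact ⟨1, one_le_two, .of_mem (List.mem_append_right _ (hj hij.symm))⟩
  · by_cases hjK : j = K
    · subst hjK
      exact ⟨1, one_le_two, .of_mem (List.mem_append_left _ (hi hiK))⟩
    · exact ⟨2, le_rfl, .append_of_mem (hi hiK) (hj hjK)⟩
end

section
/- For every nonempty demand set E there exists a 2-hop solution for E whose length is at most 2 times the minimum length of a multihop solution for E (in particular, also at most 2 times the minimum length of a 2-hop solution for E). -/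
/-- A labelling that is constant along every flight of `L` is constant along every walk
all of whose steps are flights of `L`. -/
theorem label_eq_of_walk {V : Type*} {L : List (V × V)} {c : V → V}
    (hc : ∀ p ∈ L, c p.1 = c p.2) (w : List V) :
    ∀ i j : V, w.head? = some i → w.getLast? = some j →
      (∀ p ∈ w.zip w.tail, p ∈ L) → c i = c j := by
  induction w with
  | nil => simp
  | cons a w ih =>
    intro i j hi hj hL
    cases w with
    | nil => simp_all
    | cons b w =>
      obtain rfl : a = i := by simpa using hi
      have hab : c a = c b := hc (a, b) (hL _ (by simp))
      refine hab.trans (ih b j rfl ?_ fun p hp => hL p ?_)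
      · simpa [List.getLast?_cons_cons] using hj
      · exact List.mem_cons_of_mem _ hp

theorem ServesPath.label_eq {V : Type*} {L : List (V × V)} {c : V → V}
    (hc : ∀ p ∈ L, c p.1 = c p.2) {i j : V} {l : ℕ} (h : ServesPath L i j l) : c i = c j := by
  obtain ⟨-, w, -, hi, hj, hw⟩ := h
  exact label_eq_of_walk hc w i j hi hj fun p hp => hw.subset hp

/-- A list of `m` edges leaves at least `|V| - m` connected components. -/
theorem exists_labelling {V : Type*} [Fintype V] [DecidableEq V] (L : List (V × V)) :
    ∃ c : V → V, (∀ p ∈ L, c p.1 = c p.2) ∧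
      Fintype.card V ≤ (Finset.univ.image c).card + L.length := by
  induction L with
  | nil => exact ⟨id, by simp, by simp⟩
  | cons e L ih =>
    obtain ⟨c, hc, hcard⟩ := ih
    refine ⟨fun v => if c v = c e.1 then c e.2 else c v, ?_, ?_⟩
    · intro p hp
      rcases List.mem_cons.1 hp with rfl | hp
      · simp
      · simp [hc p hp]
    · have hsub : (Finset.univ.image c).erase (c e.1) ⊆
          Finset.univ.image (fun v => if c v = c e.1 then c e.2 else c v) := by
        intro x hx
        obtain ⟨hne, hx⟩ := Finset.mem_erase.1 hx
        obtain ⟨v, -, rfl⟩ := Finset.mem_image.1 hx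
        exact Finset.mem_image.2 ⟨v, Finset.mem_univ v, if_neg hne⟩
      have h₁ := Finset.card_le_card hsub
      have h₂ := Finset.pred_card_le_card_erase (s := Finset.univ.image c) (a := c e.1)
      simp only [List.length_cons]
      omega

/-- If `r` is idempotent and the flights of `L` connect each node to its image under `r`,
then there are at least as many flights as nodes moved by `r`. -/
theorem card_moved_le_length {V : Type*} [Fintype V] [DecidableEq V] {L : List (V × V)}
    {r : V → V} (hr : ∀ v, r (r v) = r v)
    (hL : ∀ c : V → V, (∀ p ∈ L, c p.1 = c p.2) → ∀ v, c (r v) = c v) :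
    (Finset.univ.filter fun v => r v ≠ v).card ≤ L.length := by
  obtain ⟨c, hc, hcard⟩ := exists_labelling L
  have hsub : Finset.univ.image c ⊆ (Finset.univ.filter fun v => r v = v).image c := by
    intro x hx
    obtain ⟨v, -, rfl⟩ := Finset.mem_image.1 hx
    exact Finset.mem_image.2 ⟨r v, by simp [hr], hL c hc v⟩
  have h₁ := (Finset.card_le_card hsub).trans Finset.card_image_le
  have h₂ := Finset.card_filter_add_card_filter_not (s := (Finset.univ : Finset V))
    (fun v => r v = v)
  rw [Finset.card_univ] at h₂
  simp only [ne_eq]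
  omega

theorem ServesPath.of_mem_append {V : Type*} {L M : List (V × V)} {i h j : V}
    (hi : (i, h) ∈ L) (hj : (h, j) ∈ M) : ServesPath (L ++ M) i j 2 :=
  ⟨one_le_two, [i, h, j], rfl, rfl, rfl,
    (List.singleton_sublist.2 hi).append (List.singleton_sublist.2 hj)⟩

/-- Flying every moved node to its representative and then back serves every demand between
nodes with a common representative. -/
theorem isTwoHopSolution_hub {V : Type*} [Fintype V] [DecidableEq V] {E : Finset (V × V)}
    (hE : ∀ p ∈ E, p.1 ≠ p.2) {r : V → V} (hr : ∀ p ∈ E, r p.1 = r p.2) :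
    IsTwoHopSolution
      ((Finset.univ.filter fun v => r v ≠ v).toList.map (fun v => (v, r v)) ++
        (Finset.univ.filter fun v => r v ≠ v).toList.map (fun v => (r v, v))) E := by
  rintro ⟨i, j⟩ hp
  have hij : i ≠ j := hE _ hp
  have hrij : r i = r j := hr _ hp
  have hin : ∀ v, r v ≠ v →
      (v, r v) ∈ (Finset.univ.filter fun v => r v ≠ v).toList.map (fun v => (v, r v)) :=
    fun v hv => List.mem_map.2 ⟨v, by simpa using hv, rfl⟩
  have hout : ∀ v, r v ≠ v →
      (r v, v) ∈ (Finset.univ.filter fun v => r v ≠ v).toList.map (fun v => (r v, v)) :=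
    fun v hv => List.mem_map.2 ⟨v, by simpa using hv, rfl⟩
  by_cases hi : r i = i
  · have hji : r j = i := hrij.symm.trans hi
    have h := hout j (hji.trans_ne hij)
    rw [hji] at h
    exact ⟨1, one_le_two, .of_mem (List.mem_append_right _ h)⟩
  · by_cases hj : r j = j
    · have h := hin i hi
      rw [hrij.trans hj] at h
      exact ⟨1, one_le_two, .of_mem (List.mem_append_left _ h)⟩
    · exact ⟨2, le_rfl, .of_mem_append (hin i hi) (hrij ▸ hout j hj)⟩

theorem IsTwoHopSolution.isMultihopSolution {V : Type*} {L : List (V × V)}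
    {E : Finset (V × V)} (h : IsTwoHopSolution L E) : IsMultihopSolution L E :=
  fun p hp => (h p hp).imp fun _ hl => hl.2

/-- For every nonempty demand set `E` there is a 2-hop solution whose length is at most
twice the minimum length of a multihop solution (and in particular at most twice the
minimum length of a 2-hop solution). -/
theorem twohop_two_approx {V : Type*} [Fintype V] [DecidableEq V]
    (E : Finset (V × V)) (hE : ∀ p ∈ E, p.1 ≠ p.2) (hne : E.Nonempty) :
    ∃ L₂ : List (V × V), IsTwoHopSolution L₂ E ∧
      (∀ L : List (V × V), IsMultihopSolution L E → L₂.length ≤ 2 * L.length) ∧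
      (∀ L : List (V × V), IsTwoHopSolution L E → L₂.length ≤ 2 * L.length) := by
  let s : Setoid V := Relation.EqvGen.setoid fun a b => (a, b) ∈ E
  let r : V → V := fun v => (Quotient.mk s v).out
  have hrel : ∀ v, s (r v) v := fun v => Quotient.mk_out v
  have hr : ∀ v, r (r v) = r v := fun v => congrArg Quotient.out (Quotient.sound (hrel v))
  have hrE : ∀ p ∈ E, r p.1 = r p.2 := fun p hp =>
    congrArg Quotient.out (Quotient.sound (Relation.EqvGen.rel _ _ hp))
  have hbound : ∀ L, IsMultihopSolution L E →
      (Finset.univ.filter fun v => r v ≠ v).card ≤ L.length := by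
    refine fun L hL => card_moved_le_length hr fun c hc v => ?_
    have hcE : ∀ a b, Relation.EqvGen (fun a b => (a, b) ∈ E) a b → c a = c b := by
      intro a b hab
      induction hab with
      | rel a b h =>
        obtain ⟨l, hl⟩ := hL _ h
        exact hl.label_eq hc
      | refl => rfl
      | symm _ _ _ ih => exact ih.symm
      | trans _ _ _ _ _ ih₁ ih₂ => exact ih₁.trans ih₂
    exact hcE _ _ (hrel v)
  have hlen : ∀ L, IsMultihopSolution L E →
      ((Finset.univ.filter fun v => r v ≠ v).toList.map (fun v => (v, r v)) ++
        (Finset.univ.filter fun v => r v ≠ v).toList.map (fun v => (r v, v))).length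
        ≤ 2 * L.length := by
    intro L hL
    have := hbound L hL
    simp only [List.length_append, List.length_map, Finset.length_toList]
    omega
  exact ⟨_, isTwoHopSolution_hub hE hrE, hlen, fun L hL => hlen L hL.isMultihopSolution⟩
end

section
/- Let n ≥ 2 and let v_0, …, v_{n−1} be distinct nodes. For the cyclic demand set E = {(v_i, v_{(i+1) mod n}) : 0 ≤ i ≤ n−1}, the minimum length of a multihop solution for E is exactly n. -/
/-- The source of a served demand is the source of some flight. -/
theorem ServesPath.source_mem {V : Type*} {L : List (V × V)} {i j : V} {ℓ : ℕ}
    (h : ServesPath L i j ℓ) : i ∈ L.map Prod.fst := by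
  obtain ⟨hℓ, w, hlen, hhead, -, hsub⟩ := h
  match w with
  | [] => simp at hhead
  | [_] => simp at hlen; omega
  | a :: b :: w =>
    obtain rfl : a = i := by simpa using hhead
    exact List.mem_map.2 ⟨(a, b), hsub.subset (by simp), rfl⟩

/-- For `n = m + 2 ≥ 2` distinct nodes `v 0, …, v (n−1)` and the cyclic demand set
`E = {(v i, v (i+1 mod n))}`, the minimum length of a multihop solution is exactly `n`. -/
theorem cycle_multihop_minimum {V : Type*} [Fintype V] [DecidableEq V]
    (m : ℕ) (v : Fin (m + 2) → V) (hv : Function.Injective v) :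
    IsLeast {k | ∃ L : List (V × V),
      IsMultihopSolution L
        (Finset.image (fun i : Fin (m + 2) => (v i, v (i + 1))) Finset.univ) ∧
      L.length = k} (m + 2) := by
  constructor
  · refine ⟨List.ofFn fun i => (v i, v (i + 1)), fun p hp => ?_, List.length_ofFn⟩
    obtain ⟨i, -, rfl⟩ := Finset.mem_image.1 hp
    exact ⟨1, .of_mem (List.mem_ofFn.2 ⟨i, rfl⟩)⟩
  · rintro k ⟨L, hL, rfl⟩
    have hsub : Finset.univ.image v ⊆ (L.map Prod.fst).toFinset := fun x hx => by
      obtain ⟨i, -, rfl⟩ := Finset.mem_image.1 hx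
      obtain ⟨ℓ, hℓ⟩ := hL _ (Finset.mem_image_of_mem _ (Finset.mem_univ i))
      exact List.mem_toFinset.2 hℓ.source_mem
    calc m + 2 = (Finset.univ.image v).card := by
          rw [Finset.card_image_of_injective _ hv, Finset.card_fin]
      _ ≤ (L.map Prod.fst).toFinset.card := Finset.card_le_card hsub
      _ ≤ (L.map Prod.fst).length := List.toFinset_card_le _
      _ = L.length := List.length_map _
end

section
/- Let v_1, …, v_n be an enumeration of a finite node set V with n ≥ 2. The schedule consisting of the 2n−2 flights (v_1,v_2), (v_2,v_3), …, (v_{n−1},v_n), (v_n,v_1), (v_1,v_2), …, (v_{n−2},v_{n−1}), taken in this order, serves every ordered pair (v_i, v_j) with i ≠ j along a path. Consequently, for every demand set E on an n-node set there exists a multihop solution for E of length at most 2(n−1). -/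
/-- The schedule `(v₀,v₁), (v₁,v₂), …, (v_{n−2},v_{n−1}), (v_{n−1},v₀), (v₀,v₁), …,
(v_{n−3},v_{n−2})` (0-indexed, `n = m + 2`), consisting of `2n − 2` flights. -/
def cycleWalk {V : Type*} {m : ℕ} (v : Fin (m + 2) → V) : List (V × V) :=
  ((List.finRange (m + 1)).map fun i => (v i.castSucc, v i.succ)) ++
    [(v (Fin.last (m + 1)), v 0)] ++
    ((List.finRange m).map fun i => (v i.castSucc.castSucc, v i.succ.castSucc))

theorem zip_tail_map_range' {V : Type*} (g : ℕ → V) (a d : ℕ) :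
    ((List.range' a (d + 1)).map g).zip ((List.range' a (d + 1)).map g).tail =
      (List.range' a d).map fun k => (g k, g (k + 1)) := by
  apply List.ext_getElem
  · simp
  · intro k h₁ h₂
    simp [Nat.add_assoc]

/-- The schedule that walks along `g 0, g 1, …, g N` serves every pair `(g a, g b)` with
`a < b ≤ N`. -/
theorem servesPath_map_range {V : Type*} (g : ℕ → V) {N a b : ℕ} (hab : a < b) (hb : b ≤ N) :
    ServesPath ((List.range N).map fun k => (g k, g (k + 1))) (g a) (g b) (b - a) := by
  refine ⟨by omega, (List.range' a (b - a + 1)).map g, by simp, by simp [List.range'_succ], ?_, ?_⟩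
  · rw [List.getLast?_map, List.getLast?_range']
    simp
    congr 1
    omega
  · rw [zip_tail_map_range']
    apply List.Sublist.map
    have h : List.range N = List.range' 0 a ++ List.range' a (b - a) ++ List.range' b (N - b) := by
      rw [List.range_eq_range']
      apply List.ext_getElem
      · simp
        omega
      · intro k h₁ h₂
        simp only [List.getElem_append, List.getElem_range', List.length_append,
          List.length_range']
        split_ifs <;> omega
    rw [h]
    exact (List.sublist_append_right _ _).trans (List.sublist_append_left _ _)

theorem cycleWalk_eq_map_range {V : Type*} {m : ℕ} (v : Fin (m + 2) → V) :
    cycleWalk v = (List.range (2 * (m + 1))).map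
      fun k => (v (Fin.ofNat (m + 2) k), v (Fin.ofNat (m + 2) (k + 1))) := by
  apply List.ext_getElem
  · simp [cycleWalk]
    omega
  · intro k h₁ h₂
    have hk : k < 2 * (m + 1) := by simpa using h₂
    have hmod : ∀ x, m + 2 ≤ x → x < 2 * (m + 2) → x % (m + 2) = x - (m + 2) := fun x h h' => by
      rw [Nat.mod_eq_sub_mod h, Nat.mod_eq_of_lt (by omega)]
    simp only [cycleWalk, List.getElem_append, List.length_append, List.length_map,
      List.length_finRange, List.getElem_map, List.getElem_finRange, List.getElem_range,
      List.getElem_singleton, List.length_singleton]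
    split_ifs with h h'
    · congr 2 <;> ext <;> simp <;> rw [Nat.mod_eq_of_lt (by omega)]
    · have : k = m + 1 := by omega
      subst this
      congr 2 <;> ext <;> simp
    · congr 2 <;> ext <;> simp [hmod k (by omega) (by omega), hmod (k + 1) (by omega) (by omega)] <;>
        omega

/-- Going around the cycle once and then again up to `v_{n−2}` (a schedule of `2n − 2`
pigeons, `n = m + 2`) serves every ordered pair `(v i, v j)` with `i ≠ j` along a path.
Consequently, every demand set on an `n`-node set has a multihop solution of length
at most `2(n − 1)`. -/
theorem cycleWalk_serves_all {V : Type*} [Fintype V] [DecidableEq V]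
    (m : ℕ) (v : Fin (m + 2) → V) (hv : Function.Bijective v) :
    (∀ i j : Fin (m + 2), i ≠ j → ∃ ℓ, ServesPath (cycleWalk v) (v i) (v j) ℓ) ∧
      (∀ E : Finset (V × V), (∀ p ∈ E, p.1 ≠ p.2) →
        ∃ L : List (V × V), IsMultihopSolution L E ∧ L.length ≤ 2 * (m + 1)) := by
  have serves : ∀ i j : Fin (m + 2), i ≠ j →
      ∃ ℓ, ServesPath (cycleWalk v) (v i) (v j) ℓ := by
    intro i j hij
    rw [cycleWalk_eq_map_range]
    have hne : (i : ℕ) ≠ j := fun h => hij (Fin.ext h)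
    have hi : Fin.ofNat (m + 2) i = i := by simp
    rcases lt_or_gt_of_ne hne with h | h
    · have hj : Fin.ofNat (m + 2) j = j := by simp
      have key := servesPath_map_range (N := 2 * (m + 1)) (fun k => v (Fin.ofNat (m + 2) k)) h
        (by omega)
      simp only [hi, hj] at key
      exact ⟨_, key⟩
    · have hj : Fin.ofNat (m + 2) (j + (m + 2)) = j := by
        ext
        simp [Nat.mod_eq_of_lt j.isLt]
      have key := servesPath_map_range (N := 2 * (m + 1)) (a := i) (b := j + (m + 2))
        (fun k => v (Fin.ofNat (m + 2) k)) (by omega) (by omega)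
      simp only [hi, hj] at key
      exact ⟨_, key⟩
  refine ⟨serves, fun E hE => ⟨cycleWalk v, ?_, by simp [cycleWalk_eq_map_range]⟩⟩
  rintro ⟨x, y⟩ hp
  obtain ⟨i, rfl⟩ := hv.surjective x
  obtain ⟨j, rfl⟩ := hv.surjective y
  exact serves i j fun h => hE _ hp (congrArg v h)
end

section
/- Let E be a nonempty weakly connected demand set and let m* be the minimum length of a multihop solution for E. Then there exists a multihop solution for E of length m* that is a walk, i.e., in which the second component of each flight equals the first component of the next flight. -/
theorem zip_tail_concat {V : Type*} (w : List V) (d c : V) :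
    (w ++ [d, c]).zip (w ++ [d, c]).tail = (w ++ [d]).zip (w ++ [d]).tail ++ [(d, c)] := by
  induction w with
  | nil => simp
  | cons x w ih => cases w <;> simp_all

theorem zip_tail_sublist_cons {V : Type*} (x : V) (s : List V) :
    (s.zip s.tail).Sublist ((x :: s).zip (x :: s).tail) := by
  cases s <;> simp

theorem zip_tail_sublist_append_left {V : Type*} (p s : List V) :
    (s.zip s.tail).Sublist ((p ++ s).zip (p ++ s).tail) := by
  induction p with
  | nil => simp
  | cons x p ih => exact ih.trans (zip_tail_sublist_cons x (p ++ s))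

theorem zip_tail_sublist_append_right {V : Type*} (s r : List V) :
    (s.zip s.tail).Sublist ((s ++ r).zip (s ++ r).tail) := by
  induction s with
  | nil => simp
  | cons x s ih => cases s <;> simp_all

theorem isChain_zip_tail {V : Type*} (s : List V) :
    (s.zip s.tail).IsChain (fun f g => f.2 = g.1) := by
  induction s with
  | nil => simp
  | cons x s ih =>
    rcases s with _ | ⟨y, _ | ⟨z, s⟩⟩ <;> simp_all

/-- The walk through a node sequence serves every pair occurring in it in order. -/
theorem exists_servesPath_zip_tail {V : Type*} {s : List V} {x y : V}
    (h : [x, y].Sublist s) : ∃ ℓ, ServesPath (s.zip s.tail) x y ℓ := by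
  obtain ⟨p, t, rfl, hx, ht⟩ := List.cons_sublist_iff.1 h
  obtain ⟨p₁, p₂, rfl⟩ := List.append_of_mem hx
  obtain ⟨t₁, t₂, rfl⟩ := List.append_of_mem (List.singleton_sublist.1 ht)
  refine ⟨(p₂ ++ t₁).length + 1, by omega, x :: (p₂ ++ t₁) ++ [y], by simp [add_assoc], by simp,
    by rw [List.getLast?_append]; simp, ?_⟩
  have h₁ := zip_tail_sublist_append_right (x :: (p₂ ++ t₁) ++ [y]) t₂
  have h₂ := zip_tail_sublist_append_left p₁ (x :: (p₂ ++ t₁) ++ [y] ++ t₂)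
  simpa using h₁.trans h₂

/-- A path using the last flight ends with it. -/
theorem ServesPath.of_concat {V : Type*} {L : List (V × V)} {a b x y : V} {ℓ : ℕ}
    (h : ServesPath (L ++ [(a, b)]) x y ℓ) :
    (∃ k, ServesPath L x y k) ∨ (y = b ∧ (x = a ∨ ∃ k, ServesPath L x a k)) := by
  obtain ⟨hℓ, w, hw, hx, hy, hs⟩ := h
  obtain ⟨l₁, l₂, hl, h₁, h₂⟩ := List.sublist_append_iff.1 hs
  rcases List.sublist_singleton.1 h₂ with rfl | rfl
  · rw [List.append_nil] at hl
    exact Or.inl ⟨ℓ, hℓ, w, hw, hx, hy, hl ▸ h₁⟩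
  right
  rcases List.eq_nil_or_concat w with rfl | ⟨w', c, rfl⟩
  · simp at hw
  rcases List.eq_nil_or_concat w' with rfl | ⟨w, d, rfl⟩
  · simp at hw; omega
  simp only [List.concat_eq_append, List.append_assoc, List.cons_append, List.nil_append] at *
  rw [zip_tail_concat] at hl
  obtain ⟨hinit, hdc⟩ := List.append_inj' hl rfl
  simp only [List.cons.injEq, Prod.mk.injEq, and_true] at hdc
  obtain ⟨rfl, rfl⟩ := hdc
  refine ⟨by rw [List.getLast?_append] at hy; simpa using hy.symm, ?_⟩
  rcases w with _ | ⟨z, w⟩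
  · left; simpa using hx.symm
  · exact Or.inr ⟨w.length + 1, by omega, z :: w ++ [d], by simp, by simpa using hx,
      by rw [List.getLast?_append]; simp, hinit ▸ h₁⟩

/-- The nodes split into classes, each enumerated (with repetitions) by a sequence that has at
most one node more than the class has flights, so that every served pair occurs in order in the
sequence of its class. -/
theorem exists_class_sequences {V : Type*} [DecidableEq V] (L : List (V × V)) :
    ∃ f : V → List V, (∀ v, v ∈ f v) ∧ (∀ v, ∀ w ∈ f v, f w = f v) ∧
      (∀ v, (f v).length ≤ L.countP (fun e => decide (e.1 ∈ f v)) + 1) ∧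
      ∀ x y ℓ, ServesPath L x y ℓ → [x, y].Sublist (f x) := by
  induction L using List.reverseRecOn with
  | nil =>
    refine ⟨fun v => [v], by simp, by simp, by simp, ?_⟩
    rintro x y ℓ ⟨hℓ, w, hw, -, -, hs⟩
    have := congrArg List.length (List.sublist_nil.1 hs)
    simp at this
    omega
  | append_singleton L e ih =>
    obtain ⟨a, b⟩ := e
    obtain ⟨f, hmem, hcls, hlen, hserve⟩ := ih
    have hreach : ∀ x, (x = a ∨ ∃ k, ServesPath L x a k) → x ∈ f a := by
      rintro x (rfl | ⟨k, hk⟩)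
      · exact hmem _
      · rw [hcls x a ((hserve x a k hk).subset (by simp))]
        exact hmem x
    by_cases hab : b ∈ f a
    · have hiff : ∀ v, v ∈ f a ++ [b] ↔ v ∈ f a := by
        intro v
        simp only [List.mem_append, List.mem_singleton, or_iff_left_iff_imp]
        rintro rfl
        exact hab
      refine ⟨fun v => if v ∈ f a then f a ++ [b] else f v, fun v => ?_, fun v w hw => ?_,
        fun v => ?_, fun x y ℓ h => ?_⟩
      · by_cases hv : v ∈ f a
        · simp [hv]
        · simp [hv, hmem]
      · by_cases hv : v ∈ f a
        · simp only [hv, if_true, hiff] at hw ⊢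
          simp [hw]
        · simp only [hv, if_false] at hw ⊢
          have hw' : w ∉ f a := fun h => hv (by rw [← hcls a w h, hcls v w hw]; exact hmem v)
          simp only [hw', if_false]
          exact hcls v w hw
      · by_cases hv : v ∈ f a
        · simp only [hv, if_true, hiff, List.countP_append]
          have := hlen a
          simp [hmem]
          omega
        · simp only [hv, if_false, List.countP_append]
          have := hlen v
          omega
      · rcases h.of_concat with ⟨k, hk⟩ | ⟨rfl, hx⟩
        · have := hserve x y k hk
          by_cases hv : x ∈ f a
          · simp only [hv, if_true]
            rw [hcls a x hv] at this
            exact this.trans (List.sublist_append_left _ _)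
          · simpa only [hv, if_false] using this
        · have hv := hreach x hx
          simp only [hv, if_true]
          exact (List.singleton_sublist.2 hv).append (List.Sublist.refl [y])
    · have hdisj : ∀ v, v ∈ f a → v ∉ f b := fun v hva hvb =>
        hab (by rw [← hcls a v hva, hcls b v hvb]; exact hmem b)
      refine ⟨fun v => if v ∈ f a ++ f b then f a ++ f b else f v, fun v => ?_, fun v w hw => ?_,
        fun v => ?_, fun x y ℓ h => ?_⟩
      · by_cases hv : v ∈ f a ++ f b
        · simp only [hv, if_true]
        · simp only [hv, if_false, hmem]
      · by_cases hv : v ∈ f a ++ f b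
        · simp only [hv, if_true] at hw ⊢
          simp only [hw, if_true]
        · simp only [hv, if_false] at hw ⊢
          have hw' : w ∉ f a ++ f b := fun h => hv (by
            rcases List.mem_append.1 h with h | h
            · exact List.mem_append_left _ (by rw [← hcls a w h, hcls v w hw]; exact hmem v)
            · exact List.mem_append_right _ (by rw [← hcls b w h, hcls v w hw]; exact hmem v))
          simp only [hw', if_false]
          exact hcls v w hw
      · by_cases hv : v ∈ f a ++ f b
        · simp only [hv, if_true, List.countP_append, List.length_append]
          have hcount : ∀ M : List (V × V), M.countP (fun e => decide (e.1 ∈ f a ++ f b)) =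
              M.countP (fun e => decide (e.1 ∈ f a)) + M.countP (fun e => decide (e.1 ∈ f b)) := by
            intro M
            induction M with
            | nil => simp
            | cons e M ih =>
              have := hdisj e.1
              by_cases h₁ : e.1 ∈ f a <;> by_cases h₂ : e.1 ∈ f b <;>
                simp_all <;> omega
          have h₁ := hlen a
          have h₂ := hlen b
          rw [hcount]
          simp [hmem]
          omega
        · simp only [hv, if_false, List.countP_append]
          have := hlen v
          omega
      · rcases h.of_concat with ⟨k, hk⟩ | ⟨rfl, hx⟩
        · have := hserve x y k hk
          by_cases hv : x ∈ f a ++ f b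
          · simp only [hv, if_true]
            rcases List.mem_append.1 hv with h | h
            · rw [hcls a x h] at this
              exact this.trans (List.sublist_append_left _ _)
            · rw [hcls b x h] at this
              exact this.trans (List.sublist_append_right _ _)
          · simpa only [hv, if_false] using this
        · have hv := hreach x hx
          simp only [List.mem_append_left _ hv, if_true]
          exact (List.singleton_sublist.2 hv).append (List.singleton_sublist.2 (hmem y))

/-- For a nonempty weakly connected demand set, there is an optimal multihop solution
(of the minimum length `mstar`) that is a walk: the second component of each flight
equals the first component of the next flight. -/
theorem optimal_walk_solution {V : Type*} [Fintype V] [DecidableEq V]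
    (E : Finset (V × V)) (hE : ∀ p ∈ E, p.1 ≠ p.2)
    (hne : E.Nonempty) (hconn : WeaklyConnected E)
    (mstar : ℕ)
    (hm : IsLeast {m | ∃ L : List (V × V), IsMultihopSolution L E ∧ L.length = m} mstar) :
    ∃ L : List (V × V), IsMultihopSolution L E ∧ L.length = mstar ∧
      L.Chain' (fun f g => f.2 = g.1) := by
  obtain ⟨⟨L, hL, rfl⟩, hmin⟩ := hm
  obtain ⟨f, hmem, hcls, hlen, hserve⟩ := exists_class_sequences L
  have hsub : ∀ q ∈ E, [q.1, q.2].Sublist (f q.1) := fun q hq =>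
    let ⟨ℓ, h⟩ := hL q hq
    hserve _ _ ℓ h
  have hedge : ∀ q ∈ E, f q.2 = f q.1 := fun q hq =>
    hcls _ _ ((hsub q hq).subset (by simp))
  obtain ⟨p, hp⟩ := hne
  have hconst : ∀ v, Touches E v → f v = f p.1 := by
    intro v hv
    have h := hconn p.1 v ⟨p, hp, Or.inl rfl⟩ hv
    clear hv
    induction h with
    | refl => rfl
    | tail _ hbc ih =>
      rcases hbc with h | h
      · exact (hedge _ h).trans ih
      · exact (hedge _ h).symm.trans ih
  have hsol : IsMultihopSolution ((f p.1).zip (f p.1).tail) E := fun q hq =>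
    exists_servesPath_zip_tail (hconst q.1 ⟨q, hq, Or.inl rfl⟩ ▸ hsub q hq)
  refine ⟨_, hsol, le_antisymm ?_ (hmin ⟨_, hsol, rfl⟩), isChain_zip_tail _⟩
  have h₁ := hlen p.1
  have h₂ : L.countP (fun e => decide (e.1 ∈ f p.1)) ≤ L.length := List.countP_le_length
  simp only [List.length_zip, List.length_tail]
  omega
end

section
/- Let E be a demand set on a finite node set V with |V| = n ≥ 2, let N = 2n−2, and consider the integer program with binary variables x^i_{u,v} for u,v ∈ V and i ∈ {1,…,N}, and y^i_{u,w,v} for (u,v) ∈ E, w ∈ V and i ∈ {1,…,N}, subject to: (1) Σ_{u,v ∈ V} x^i_{u,v} ≤ 1 for every i; (2) Σ_{i=1}^{N} ( x^i_{u,v} + Σ_{w ∈ V} y^i_{u,w,v} ) ≥ 1 for every (u,v) ∈ E; (3) y^i_{u,w,v} ≤ x^i_{u,w} for every (u,v) ∈ E, w ∈ V, i; (4) y^i_{u,w,v} ≤ Σ_{j=i+1}^{N} x^j_{w,v} for every (u,v) ∈ E, w ∈ V, i. Then for every natural number k, there exists a feasible binary assignment with Σ_{u,v,i} x^i_{u,v}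 ≤ k if and only if there exists a 2-hop solution for E of length at most k. -/
theorem List.pair_sublist_iff {α : Type*} {a b : α} {L : List α} :
    [a, b].Sublist L ↔ ∃ i j : ℕ, i < j ∧ L[i]? = some a ∧ L[j]? = some b := by
  induction L with
  | nil => simp
  | cons c L ih =>
    constructor
    · intro h
      cases h with
      | cons _ h =>
        obtain ⟨i, j, hij, hi, hj⟩ := ih.1 h
        exact ⟨i + 1, j + 1, by omega, by simpa using hi, by simpa using hj⟩
      | cons_cons _ h =>
        obtain ⟨j, hj⟩ := List.mem_iff_getElem?.1 (List.singleton_sublist.1 h)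
        exact ⟨0, j + 1, by omega, by simp, by simpa using hj⟩
    · rintro ⟨i, j, hij, hi, hj⟩
      obtain ⟨j, rfl⟩ : ∃ j', j = j' + 1 := ⟨j - 1, by omega⟩
      rw [List.getElem?_cons_succ] at hj
      cases i with
      | zero =>
        obtain rfl : c = a := by simpa using hi
        exact (List.singleton_sublist.2 (List.mem_of_getElem? hj)).cons_cons c
      | succ i =>
        rw [List.getElem?_cons_succ] at hi
        exact (ih.2 ⟨i, j, by omega, hi, hj⟩).cons c

theorem List.length_filterMap_eq_sum {α β : Type*} (s : α → Option β) (l : List α) :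
    (l.filterMap s).length = (l.map fun a => if (s a).isSome then 1 else 0).sum := by
  induction l with
  | nil => simp
  | cons a l ih =>
    cases h : s a <;> simp [h, ih, Nat.add_comm]

theorem exists_le_two_servesPath_iff {V : Type*} {L : List (V × V)} {u v : V} (huv : u ≠ v) :
    (∃ ℓ ≤ 2, ServesPath L u v ℓ) ↔ (u, v) ∈ L ∨ ∃ w, [(u, w), (w, v)].Sublist L := by
  constructor
  · rintro ⟨ℓ, hℓ, hℓ', w, hw, hu, hv, hs⟩
    match w, hw with
    | [], hw => simp at hw
    | [a], hw =>
      simp at hu hv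
      exact absurd (hu.symm.trans hv) huv
    | [a, b], hw =>
      simp only [List.head?_cons, Option.some.injEq] at hu
      simp only [List.getLast?_cons_cons, List.getLast?_singleton, Option.some.injEq] at hv
      subst hu hv
      exact .inl (by simpa using hs)
    | [a, c, b], hw =>
      simp only [List.head?_cons, Option.some.injEq] at hu
      simp only [List.getLast?_cons_cons, List.getLast?_singleton, Option.some.injEq] at hv
      subst hu hv
      exact .inr ⟨c, by simpa using hs⟩
    | _ :: _ :: _ :: _ :: _, hw =>
      simp only [List.length_cons] at hw
      omega
  · rintro (h | ⟨w, h⟩)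
    · exact ⟨1, by norm_num, le_rfl, [u, v], by simpa using h⟩
    · exact ⟨2, le_rfl, by norm_num, [u, w, v], by simpa using h⟩

theorem isTwoHopSolution_iff {V : Type*} {L : List (V × V)} {E : Finset (V × V)}
    (hE : ∀ p ∈ E, p.1 ≠ p.2) :
    IsTwoHopSolution L E ↔
      ∀ p ∈ E, p ∈ L ∨ ∃ w, [(p.1, w), (w, p.2)].Sublist L :=
  forall₂_congr fun p hp => exists_le_two_servesPath_iff (hE p hp)

/-- Collecting all messages at a hub and then distributing them is a 2-hop solution. -/
theorem exists_isTwoHopSolution_length_eq {V : Type*} [Fintype V] [Nonempty V]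
    (E : Finset (V × V)) (hE : ∀ p ∈ E, p.1 ≠ p.2) :
    ∃ L : List (V × V), IsTwoHopSolution L E ∧ L.length = 2 * Fintype.card V - 2 := by
  classical
  obtain ⟨h⟩ := ‹Nonempty V›
  let S : List V := (Finset.univ.erase h).toList
  have mem_S {v : V} (hv : v ≠ h) : v ∈ S := by simp [S, hv]
  refine ⟨S.map (·, h) ++ S.map (h, ·), (isTwoHopSolution_iff hE).2 ?_, ?_⟩
  · rintro ⟨u, v⟩ hp
    have huv : u ≠ v := hE _ hp
    by_cases hu : u = h
    · subst hu
      exact .inl (List.mem_append_right _ (List.mem_map_of_mem (mem_S huv.symm)))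
    by_cases hv : v = h
    · subst hv
      exact .inl (List.mem_append_left _ (List.mem_map.2 ⟨u, mem_S hu, rfl⟩))
    refine .inr ⟨h, List.Sublist.append (l₁ := [(u, h)]) (r₁ := [(h, v)]) ?_ ?_⟩
    · exact List.singleton_sublist.2 (List.mem_map.2 ⟨u, mem_S hu, rfl⟩)
    · exact List.singleton_sublist.2 (List.mem_map_of_mem (mem_S hv))
  · simp [S, Finset.card_erase_of_mem]
    omega

theorem sum_ite_eq_some_pair {V : Type*} [Fintype V] [DecidableEq V] (o : Option (V × V)) :
    (∑ u : V, ∑ v : V, if o = some (u, v) then 1 else 0) = if o.isSome then 1 else 0 := by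
  rw [← Fintype.sum_prod_type' (f := fun u v => if o = some (u, v) then 1 else 0)]
  cases o <;> simp

/-- The schedule read off from a family of time slots, each carrying at most one flight. -/
theorem exists_list_of_slots {V : Type*} [Fintype V] {N : ℕ} (x : Fin N → V → V → ℕ)
    (hx : ∀ i, ∑ u : V, ∑ v : V, x i u v ≤ 1) :
    ∃ L : List (V × V), L.length ≤ ∑ i, ∑ u : V, ∑ v : V, x i u v ∧
      (∀ i u v, x i u v ≠ 0 → (u, v) ∈ L) ∧
      ∀ i j u v u' v', i < j → x i u v ≠ 0 → x j u' v' ≠ 0 →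
        [(u, v), (u', v')].Sublist L := by
  classical
  have slot (i : Fin N) : ∃ o : Option (V × V), ∀ p, x i p.1 p.2 ≠ 0 ↔ o = some p := by
    by_cases h : ∃ p : V × V, x i p.1 p.2 ≠ 0
    · obtain ⟨p, hp⟩ := h
      refine ⟨some p, fun q => ⟨fun hq => ?_, ?_⟩⟩
      · by_contra hpq
        have hpq' : p ≠ q := fun h => hpq (congrArg some h)
        have hle := Finset.sum_le_sum_of_subset (f := fun r : V × V => x i r.1 r.2)
          (Finset.subset_univ {p, q})
        rw [Finset.sum_pair hpq', Fintype.sum_prod_type] at hle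
        have := hx i
        dsimp only at hle
        omega
      · rintro ⟨⟩
        exact hp
    · push Not at h
      exact ⟨none, fun p => by simp [h p]⟩
  choose s hs using slot
  refine ⟨(List.finRange N).filterMap s, ?_, fun i u v h => ?_, fun i j u v u' v' hij h h' => ?_⟩
  · rw [List.length_filterMap_eq_sum, ← Fin.sum_univ_def]
    refine Finset.sum_le_sum fun i _ => ?_
    rw [← sum_ite_eq_some_pair]
    refine Finset.sum_le_sum fun u _ => Finset.sum_le_sum fun v _ => ?_
    split_ifs with h
    · exact Nat.one_le_iff_ne_zero.2 ((hs i (u, v)).2 h)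
    · exact Nat.zero_le _
  · exact List.mem_filterMap.2 ⟨i, List.mem_finRange i, (hs i (u, v)).1 h⟩
  · have hsub : [i, j].Sublist (List.finRange N) :=
      List.pair_sublist_iff.2 ⟨i, j, hij, by simp, by simp⟩
    simpa [(hs i (u, v)).1 h, (hs j (u', v')).1 h'] using hsub.filterMap s

theorem sum_isSome_getElem?_le {α : Type*} (L : List α) (N : ℕ) :
    (∑ i : Fin N, if (L[(i : ℕ)]?).isSome then 1 else 0) ≤ L.length := by
  rw [Fin.sum_univ_eq_sum_range (fun i => if (L[i]?).isSome then 1 else 0) N,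
    ← Finset.card_filter]
  calc _ ≤ (Finset.range L.length).card := Finset.card_le_card fun i => by simp
    _ = L.length := Finset.card_range _

/-- Correctness of the ILP for the 2-hop problem: with `N = 2n − 2` time slots, binary
variables `x^i_{u,v}` (the `i`-th pigeon flies from `u` to `v`) and `y^i_{u,w,v}`
(demand `(u,v)` is routed via `w`, picked up by pigeon `i`), subject to constraints
(1)–(4), a feasible assignment with `Σ x ≤ k` exists iff a 2-hop solution of length
at most `k` exists. -/
theorem twohop_ILP_correct {V : Type*} [Fintype V] [DecidableEq V]
    (n : ℕ) (hn : 2 ≤ n) (hcard : Fintype.card V = n)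
    (E : Finset (V × V)) (hE : ∀ p ∈ E, p.1 ≠ p.2) (k : ℕ) :
    (∃ (x : Fin (2 * n - 2) → V → V → ℕ) (y : Fin (2 * n - 2) → V → V → V → ℕ),
      (∀ i u v, x i u v ≤ 1) ∧
      (∀ i u w v, y i u w v ≤ 1) ∧
      (∀ i, ∑ u : V, ∑ v : V, x i u v ≤ 1) ∧
      (∀ p ∈ E, 1 ≤ ∑ i : Fin (2 * n - 2), (x i p.1 p.2 + ∑ w : V, y i p.1 w p.2)) ∧
      (∀ p ∈ E, ∀ w : V, ∀ i, y i p.1 w p.2 ≤ x i p.1 w) ∧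
      (∀ p ∈ E, ∀ w : V, ∀ i,
        y i p.1 w p.2 ≤ ∑ j ∈ Finset.univ.filter (fun j => i < j), x j w p.2) ∧
      (∑ i : Fin (2 * n - 2), ∑ u : V, ∑ v : V, x i u v ≤ k)) ↔
    (∃ L : List (V × V), IsTwoHopSolution L E ∧ L.length ≤ k) := by
  classical
  have : Nonempty V := Fintype.card_pos_iff.1 (by omega)
  constructor
  · rintro ⟨x, y, -, -, hx, hserve, hpick, hdeliver, hk⟩
    obtain ⟨L, hlen, hmem, hpair⟩ := exists_list_of_slots x hx
    refine ⟨L, (isTwoHopSolution_iff hE).2 fun p hp => ?_, hlen.trans hk⟩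
    obtain ⟨i, -, hi⟩ := Finset.exists_ne_zero_of_sum_ne_zero
      (Nat.one_le_iff_ne_zero.1 (hserve p hp))
    by_cases hxi : x i p.1 p.2 = 0
    · rw [hxi, zero_add] at hi
      obtain ⟨w, -, hw⟩ := Finset.exists_ne_zero_of_sum_ne_zero hi
      have hxw : x i p.1 w ≠ 0 := by have := hpick p hp w i; omega
      obtain ⟨j, hj, hxj⟩ := Finset.exists_ne_zero_of_sum_ne_zero
        (show ∑ j ∈ Finset.univ.filter (fun j => i < j), x j w p.2 ≠ 0 by
          have := hdeliver p hp w i; omega)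
      exact .inr ⟨w, hpair i j _ _ _ _ (Finset.mem_filter.1 hj).2 hxw hxj⟩
    · exact .inl (hmem i _ _ hxi)
  · rintro ⟨L₀, hL₀, hk₀⟩
    obtain ⟨L, hL, hk, hN⟩ : ∃ L : List (V × V),
        IsTwoHopSolution L E ∧ L.length ≤ k ∧ L.length ≤ 2 * n - 2 := by
      by_cases h : L₀.length ≤ 2 * n - 2
      · exact ⟨L₀, hL₀, hk₀, h⟩
      · obtain ⟨L, hL, hlen⟩ := exists_isTwoHopSolution_length_eq E hE
        exact ⟨L, hL, by omega, by omega⟩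
    have lt_of_getElem? {i : ℕ} {p : V × V} (h : L[i]? = some p) : i < 2 * n - 2 :=
      (List.getElem?_eq_some_iff.1 h).1.trans_le hN
    refine ⟨fun i u v => if L[(i : ℕ)]? = some (u, v) then 1 else 0,
      fun i u w v => if L[(i : ℕ)]? = some (u, w) ∧
        ∃ j : Fin (2 * n - 2), i < j ∧ L[(j : ℕ)]? = some (w, v) then 1 else 0,
      ?_, ?_, ?_, ?_, ?_, ?_, ?_⟩
    · intro i u v
      dsimp only
      split_ifs <;> simp
    · intro i u w v
      dsimp only
      split_ifs <;> simp
    · intro i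
      rw [sum_ite_eq_some_pair]
      split_ifs <;> simp
    · intro p hp
      rw [Nat.one_le_iff_ne_zero]
      intro h0
      simp only [Finset.sum_eq_zero_iff, Finset.mem_univ, true_imp_iff, Nat.add_eq_zero_iff,
        ite_eq_right_iff, one_ne_zero, imp_false] at h0
      rcases (isTwoHopSolution_iff hE).1 hL p hp with h | ⟨w, h⟩
      · obtain ⟨i, hi⟩ := List.mem_iff_getElem?.1 h
        exact (h0 ⟨i, lt_of_getElem? hi⟩).1 hi
      · obtain ⟨i, j, hij, hi, hj⟩ := List.pair_sublist_iff.1 h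
        exact (h0 ⟨i, lt_of_getElem? hi⟩).2 w ⟨hi, ⟨j, lt_of_getElem? hj⟩, hij, hj⟩
    · intro p _ w i
      dsimp only
      split_ifs with h h' <;> simp_all
    · intro p _ w i
      dsimp only
      split_ifs with h
      · obtain ⟨-, j, hij, hj⟩ := h
        refine le_trans (by simp [hj]) (Finset.single_le_sum (fun _ _ => Nat.zero_le _)
          (Finset.mem_filter.2 ⟨Finset.mem_univ j, hij⟩))
      · exact Nat.zero_le _
    · simp only [sum_ite_eq_some_pair]
      exact (sum_isSome_getElem?_le L _).trans hk
end

section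
/- Let G = (V, E_G) be an undirected graph and K ⊆ V a vertex cover of G. Let π be a list enumerating the elements of K (each exactly once) and τ a list enumerating the elements of V \ K (each exactly once). Then for every edge {u,v} ∈ E_G, in the concatenated list π ++ τ ++ π there is a position holding u strictly before a position holding v, and also a position holding v strictly before a position holding u. -/
/-- `a` occurs strictly before `b` in the list `l`: there are positions `p < q`
holding `a` and `b` respectively. -/
def OccursBefore {V : Type*} (l : List V) (a b : V) : Prop :=
  ∃ p q : ℕ, p < q ∧ l[p]? = some a ∧ l[q]? = some b

/-- An element of `l₁` occurs before every element of `l₂` in `l₁ ++ l₂`. -/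
theorem OccursBefore.append_of_mem {V : Type*} {l₁ l₂ : List V} {a b : V}
    (ha : a ∈ l₁) (hb : b ∈ l₂) : OccursBefore (l₁ ++ l₂) a b := by
  obtain ⟨p, hp⟩ := List.mem_iff_getElem?.mp ha
  obtain ⟨q, hq⟩ := List.mem_iff_getElem?.mp hb
  obtain ⟨hlt, -⟩ := List.getElem?_eq_some_iff.mp hp
  refine ⟨p, l₁.length + q, by lia, ?_, ?_⟩
  · rwa [List.getElem?_append_left hlt]
  · rwa [List.getElem?_append_right (Nat.le_add_right _ _), Nat.add_sub_cancel_left]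

/-- In `π ++ τ ++ π`, every element of `π` occurs both before and after every element
of `π` or `τ`. -/
theorem occursBefore_append_append_self {V : Type*} {π τ : List V} {a b : V}
    (ha : a ∈ π) (hb : b ∈ π ∨ b ∈ τ) :
    OccursBefore (π ++ τ ++ π) a b ∧ OccursBefore (π ++ τ ++ π) b a := by
  refine ⟨?_, OccursBefore.append_of_mem (List.mem_append.mpr hb) ha⟩
  rw [List.append_assoc]
  exact OccursBefore.append_of_mem ha (List.mem_append.mpr hb.symm)

/-- Let `K` be a vertex cover of `G`, let `π` enumerate `K` and `τ` enumerate `V \ K`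
(each element exactly once). Then for every edge `{u,v}` of `G`, in `π ++ τ ++ π`
some occurrence of `u` is strictly before an occurrence of `v`, and some occurrence
of `v` is strictly before an occurrence of `u`. -/
theorem cover_enumeration_before {V : Type*} [Fintype V] [DecidableEq V]
    (G : SimpleGraph V) (K : Finset V)
    (hK : ∀ u v : V, G.Adj u v → u ∈ K ∨ v ∈ K)
    (π τ : List V)
    (hπnd : π.Nodup) (hπ : ∀ v : V, v ∈ π ↔ v ∈ K)
    (hτnd : τ.Nodup) (hτ : ∀ v : V, v ∈ τ ↔ v ∉ K)
    (u v : V) (huv : G.Adj u v) :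
    OccursBefore (π ++ τ ++ π) u v ∧ OccursBefore (π ++ τ ++ π) v u := by
  have mem_or (w : V) : w ∈ π ∨ w ∈ τ := by
    rw [hπ, hτ]
    exact em _
  rcases hK u v huv with hu | hv
  · exact occursBefore_append_append_self ((hπ u).mpr hu) (mem_or v)
  · exact (occursBefore_append_append_self ((hπ v).mpr hv) (mem_or u)).symm
end

section
/- Let E be a nonempty weakly connected demand set on a finite node set V with |V| = n, and consider the integer program with binary variables x^i_v for v ∈ V and i ∈ {1,…,2n}, and y^{i,j}_{u,v} for (u,v) ∈ E and 1 ≤ i < j ≤ 2n, subject to: (1) Σ_{v ∈ V} x^i_v ≤ 1 for every i; (2) Σ_{1 ≤ i < j ≤ 2n} y^{i,j}_{u,v} = 1 for every (u,v) ∈ E; (3) 2·y^{i,j}_{u,v} ≤ x^i_u + x^j_v for every (u,v) ∈ E and i < j. Then for every natural number k, there exists a multihop solution for E of length at most k if and only if there exists a feasible binary assignment with Σ_{v,i} x^i_v ≤ k + 1. -/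
/-- `x` reaches `y` along a (possibly empty) path of flights at increasing positions of `L`. -/
def Reaches {V : Type*} : List (V × V) → V → V → Prop
  | [], x, y => x = y
  | f :: L, x, y => Reaches L x y ∨ (x = f.1 ∧ Reaches L f.2 y)

theorem Reaches.refl {V : Type*} (L : List (V × V)) (x : V) : Reaches L x x := by
  induction L with
  | nil => rfl
  | cons f L ih => exact Or.inl ih

theorem Reaches.of_zip_sublist {V : Type*} {y : V} (L : List (V × V)) :
    ∀ (x : V) (r : List V), (x :: r).getLast? = some y → ((x :: r).zip r).Sublist L →
      Reaches L x y := by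
  induction L with
  | nil =>
    intro x r hl hs
    cases r with
    | nil => simpa [Reaches] using hl
    | cons a r => simp at hs
  | cons f L ih =>
    intro x r hl hs
    cases r with
    | nil =>
      obtain rfl : x = y := by simpa using hl
      exact Reaches.refl _ _
    | cons a r =>
      rw [List.zip_cons_cons] at hs
      cases hs with
      | cons _ h => exact Or.inl (ih x (a :: r) hl (by rwa [List.zip_cons_cons]))
      | cons_cons _ h => exact Or.inr ⟨rfl, ih a r (by simpa using hl) h⟩

theorem ServesPath.reaches {V : Type*} {L : List (V × V)} {i j : V} {l : ℕ}
    (h : ServesPath L i j l) : Reaches L i j := by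
  obtain ⟨-, w, -, hh, hl, hs⟩ := h
  cases w with
  | nil => simp at hh
  | cons x r =>
    obtain rfl : x = i := by simpa using hh
    exact Reaches.of_zip_sublist L x r hl hs

theorem pair_sublist_append {V : Type*} {x y : V} {s t : List V} (hx : x ∈ s) (hy : y ∈ t) :
    [x, y].Sublist (s ++ t) :=
  (List.singleton_sublist.2 hx).append (List.singleton_sublist.2 hy)

/-- Every weak component of a schedule carries a word, at most one longer than the number of
flights in the component, in which `x` occurs before `y` whenever `x ≠ y` and `x` reaches `y`. -/
theorem exists_component_words {V : Type*} [DecidableEq V] (L : List (V × V)) :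
    ∃ W : V → List V, (∀ v, v ∈ W v) ∧ (∀ x y, y ∈ W x → W y = W x) ∧
      (∀ v, (W v).length ≤ 1 + L.countP (fun f => f.2 ∈ W v)) ∧
      (∀ x y, Reaches L x y → x = y ∨ [x, y].Sublist (W x)) := by
  induction L with
  | nil =>
    refine ⟨fun v => [v], by simp, ?_, by simp, fun x y h => Or.inl h⟩
    intro x y h
    rw [List.mem_singleton.1 h]
  | cons f L ih =>
    obtain ⟨a, b⟩ := f
    obtain ⟨W, hself, heq, hlen, hreach⟩ := ih
    obtain ⟨M, hM, hMlen, hMa, hMb, hab⟩ : ∃ M : List V, (∀ v, v ∈ M ↔ v ∈ W a ∨ v ∈ W b) ∧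
        M.length ≤ 2 + L.countP (fun f => f.2 ∈ M) ∧ (W a).Sublist M ∧ (W b).Sublist M ∧
        ∀ y ∈ W b, [a, y].Sublist M := by
      by_cases hc : a ∈ W b
      · have hW := heq _ _ hc
        have hmem : ∀ v, v ∈ a :: W b ↔ v ∈ W b := by
          intro v
          simp only [List.mem_cons, or_iff_right_iff_imp]
          rintro rfl
          exact hc
        refine ⟨a :: W b, by simpa [hW] using hc, ?_, by simp [hW], by simp, ?_⟩
        · simp only [hmem, List.length_cons]
          have := hlen b
          omega
        · intro y hy
          exact (List.singleton_sublist.2 hy).cons_cons a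
      · refine ⟨W a ++ W b, by simp, ?_, by simp, by simp, ?_⟩
        · have hdisj : ∀ v, v ∈ W a → v ∉ W b := by
            intro v hva hvb
            apply hc
            rw [← heq _ _ hvb, heq _ _ hva]
            exact hself a
          have hcount : ∀ K : List (V × V), K.countP (fun f => f.2 ∈ W a ++ W b) =
              K.countP (fun f => f.2 ∈ W a) + K.countP (fun f => f.2 ∈ W b) := by
            intro K
            induction K with
            | nil => simp
            | cons g K ih =>
              have := hdisj g.2
              rw [List.countP_cons, List.countP_cons, List.countP_cons, ih]
              simp only [List.mem_append, decide_eq_true_eq]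
              by_cases h1 : g.2 ∈ W a
              · simp only [h1, this h1, or_false, if_true, if_false]
                omega
              · by_cases h2 : g.2 ∈ W b
                · simp only [h1, h2, or_true, if_true, if_false]
                  omega
                · simp [h1, h2]
          have h1 := hlen a
          have h2 := hlen b
          rw [hcount, List.length_append]
          omega
        · intro y hy
          exact pair_sublist_append (hself a) hy
    have hout : ∀ x y, x ∉ M → y ∈ W x → y ∉ M := by
      intro x y hx hy hyM
      apply hx
      rw [hM] at hyM ⊢
      rcases hyM with h | h
      · left; rw [← heq _ _ h, heq _ _ hy]; exact hself x
      · right; rw [← heq _ _ h, heq _ _ hy]; exact hself x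
    have hsub : ∀ x ∈ M, (W x).Sublist M := by
      intro x hx
      rcases (hM x).1 hx with h | h
      · rwa [heq _ _ h]
      · rwa [heq _ _ h]
    have haM : a ∈ M := (hM a).2 (Or.inl (hself a))
    have hbM : b ∈ M := (hM b).2 (Or.inr (hself b))
    refine ⟨fun v => if v ∈ M then M else W v, ?_, ?_, ?_, ?_⟩
    · intro v
      dsimp only
      split_ifs with h
      · exact h
      · exact hself v
    · intro x y hy
      dsimp only at hy ⊢
      by_cases hx : x ∈ M
      · rw [if_pos hx] at hy ⊢
        rw [if_pos hy]
      · rw [if_neg hx] at hy ⊢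
        rw [if_neg (hout x y hx hy)]
        exact heq _ _ hy
    · intro v
      dsimp only
      split_ifs with h
      · rw [List.countP_cons_of_pos (by simpa using hbM)]
        omega
      · exact (hlen v).trans (Nat.add_le_add_left (List.sublist_cons_self _ _).countP_le 1)
    · intro x y hxy
      dsimp only
      rcases hxy with h | ⟨rfl, h⟩
      · rcases hreach x y h with h | h
        · exact Or.inl h
        · right
          split_ifs with hx
          · exact h.trans (hsub x hx)
          · exact h
      · right
        rw [if_pos haM]
        apply hab
        rcases hreach b y h with h | h
        · rw [← h]; exact hself b
        · exact h.subset (by simp)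

/-- A multihop solution of a weakly connected demand set yields a word, at most one longer,
in which the source of every demand occurs before its target. -/
theorem IsMultihopSolution.exists_word {V : Type*} [DecidableEq V] {E : Finset (V × V)}
    (hE : ∀ p ∈ E, p.1 ≠ p.2) (hne : E.Nonempty) (hconn : WeaklyConnected E)
    {L : List (V × V)} (hL : IsMultihopSolution L E) :
    ∃ w : List V, w.length ≤ L.length + 1 ∧ ∀ p ∈ E, [p.1, p.2].Sublist w := by
  obtain ⟨W, hself, heq, hlen, hreach⟩ := exists_component_words L
  obtain ⟨q, hq⟩ := hne
  have hpair : ∀ p ∈ E, [p.1, p.2].Sublist (W p.1) := by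
    intro p hp
    obtain ⟨l, h⟩ := hL p hp
    exact (hreach _ _ h.reaches).resolve_left (hE p hp)
  have hedge : ∀ u v, (u, v) ∈ E → W v = W u := fun u v h =>
    heq _ _ ((hpair _ h).subset (by simp))
  have hall : ∀ u v, Relation.ReflTransGen (fun a b => (a, b) ∈ E ∨ (b, a) ∈ E) u v →
      W v = W u := by
    intro u v h
    induction h with
    | refl => rfl
    | tail _ h ih =>
      rcases h with h | h
      · rw [hedge _ _ h, ih]
      · rw [← hedge _ _ h, ih]
  refine ⟨W q.1, ?_, ?_⟩
  · have h1 := hlen q.1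
    have h2 := List.countP_le_length (p := fun f : V × V => decide (f.2 ∈ W q.1)) (l := L)
    omega
  · intro p hp
    rw [← hall q.1 p.1 (hconn _ _ ⟨q, hq, Or.inl rfl⟩ ⟨p, hp, Or.inl rfl⟩)]
    exact hpair p hp

theorem zip_tail_sublist_of_append {V : Type*} (s m t : List V) :
    (m.zip m.tail).Sublist ((s ++ m ++ t).zip (s ++ m ++ t).tail) := by
  induction s with
  | nil =>
    induction m with
    | nil => simp
    | cons a m ih =>
      cases m with
      | nil => simp
      | cons b m => simpa using ih
  | cons a s ih =>
    refine ih.trans ?_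
    simp only [List.cons_append, List.tail_cons]
    generalize s ++ m ++ t = r
    cases r with
    | nil => simp
    | cons b r => simp

theorem exists_servesPath_of_pair_sublist {V : Type*} {u v : V} {w : List V}
    (h : [u, v].Sublist w) : ∃ l, ServesPath (w.zip w.tail) u v l := by
  obtain ⟨r₁, r₂, rfl, hu, hv⟩ := List.cons_sublist_iff.1 h
  obtain ⟨s, t, rfl⟩ := List.append_of_mem hu
  obtain ⟨p, q, rfl⟩ := List.append_of_mem (List.singleton_sublist.1 hv)
  refine ⟨t.length + p.length + 1, by omega, u :: (t ++ p ++ [v]), by simp; omega, by simp,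
    ?_, ?_⟩
  · rw [← List.cons_append, List.getLast?_concat]
  · have := zip_tail_sublist_of_append s (u :: (t ++ p ++ [v])) q
    simpa using this

theorem exists_word_of_assignment {V : Type*} [Fintype V] {N : ℕ} (x : Fin N → V → ℕ)
    (hx : ∀ i, ∑ v : V, x i v ≤ 1) :
    ∃ w : List V, w.length ≤ ∑ i, ∑ v, x i v ∧
      ∀ i j u v, i < j → x i u = 1 → x j v = 1 → [u, v].Sublist w := by
  classical
  let o : Fin N → Option V := fun i => if h : ∃ v, x i v = 1 then some h.choose else none
  have ho : ∀ i v, x i v = 1 → o i = some v := by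
    intro i v hv
    have h : ∃ v, x i v = 1 := ⟨v, hv⟩
    have hs := h.choose_spec
    simp only [o, dif_pos h, Option.some.injEq]
    by_contra hne
    have h2 := Finset.sum_le_univ_sum_of_nonneg (f := x i) (s := {h.choose, v})
      (fun _ => Nat.zero_le _)
    rw [Finset.sum_pair hne] at h2
    have := hx i
    omega
  refine ⟨(List.finRange N).filterMap o, ?_, ?_⟩
  · have hle : ∀ l : List (Fin N), (l.filterMap o).length ≤ (l.map fun i => ∑ v, x i v).sum := by
      intro l
      induction l with
      | nil => simp
      | cons i l ih =>
        by_cases h : ∃ v, x i v = 1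
        · obtain ⟨v, hv⟩ := h
          have := Finset.single_le_sum (f := x i) (fun _ _ => Nat.zero_le _) (Finset.mem_univ v)
          rw [List.filterMap_cons_some (ho i v hv), List.map_cons, List.sum_cons,
            List.length_cons]
          omega
        · rw [List.filterMap_cons_none (by simp only [o, dif_neg h]), List.map_cons,
            List.sum_cons]
          omega
    refine (hle _).trans (le_of_eq ?_)
    rw [← List.ofFn_eq_map, List.sum_ofFn]
  · intro i j u v hij hu hv
    have hs : [i, j].Sublist (List.finRange N) := by
      refine List.sublist_of_subperm_of_pairwise (r := (· < ·)) ?_ ?_ ?_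
      · exact (List.nodup_cons.2 ⟨by simpa using hij.ne, by simp⟩).subperm (by simp)
      · simpa using hij
      · exact List.pairwise_lt_finRange N
    have := hs.filterMap o
    simpa [ho i u hu, ho j v hv] using this

theorem exists_assignment_of_word {V : Type*} [Fintype V] [DecidableEq V] {N : ℕ}
    {E : Finset (V × V)} {w : List V} (hw : w.length ≤ N)
    (hE : ∀ p ∈ E, [p.1, p.2].Sublist w) :
    ∃ (x : Fin N → V → ℕ) (y : Fin N → Fin N → V → V → ℕ),
      (∀ i v, x i v ≤ 1) ∧
      (∀ i j u v, y i j u v ≤ 1) ∧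
      (∀ i, ∑ v : V, x i v ≤ 1) ∧
      (∀ p ∈ E, ∑ i : Fin N, ∑ j ∈ Finset.univ.filter (fun j => i < j), y i j p.1 p.2 = 1) ∧
      (∀ p ∈ E, ∀ i j : Fin N, i < j → 2 * y i j p.1 p.2 ≤ x i p.1 + x j p.2) ∧
      (∑ i : Fin N, ∑ v : V, x i v ≤ w.length) := by
  have hidx : ∀ p ∈ E, ∃ q : Fin N × Fin N,
      q.1 < q.2 ∧ w[(q.1 : ℕ)]? = some p.1 ∧ w[(q.2 : ℕ)]? = some p.2 := by
    intro p hp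
    obtain ⟨f, hf⟩ := List.sublist_iff_exists_fin_orderEmbedding_get_eq.1 (hE p hp)
    have h0 := hf ⟨0, by simp⟩
    have h1 := hf ⟨1, by simp⟩
    refine ⟨((f ⟨0, by simp⟩).castLE hw, (f ⟨1, by simp⟩).castLE hw), ?_, ?_, ?_⟩
    · exact f.lt_iff_lt.2 (by simp)
    · simpa using h0.symm
    · simpa using h1.symm
  choose g hg using hidx
  have hrow : ∀ i : Fin N, ∑ v : V, (if w[(i : ℕ)]? = some v then 1 else 0) =
      if (i : ℕ) < w.length then 1 else 0 := by
    intro i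
    by_cases h : (i : ℕ) < w.length
    · simp [h]
    · simp [h]
  refine ⟨fun i v => if w[(i : ℕ)]? = some v then 1 else 0,
    fun i j u v => if ∃ h : (u, v) ∈ E, g (u, v) h = (i, j) then 1 else 0, ?_, ?_, ?_, ?_, ?_, ?_⟩
  · intro i v
    dsimp only
    split_ifs <;> simp
  · intro i j u v
    dsimp only
    split_ifs <;> simp
  · intro i
    dsimp only
    rw [hrow]
    split_ifs <;> simp
  · intro p hp
    obtain ⟨hlt, -, -⟩ := hg p hp
    dsimp only
    rw [Finset.sum_eq_single (g p hp).1]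
    · rw [Finset.sum_eq_single (g p hp).2]
      · exact if_pos ⟨hp, rfl⟩
      · intro j _ hj
        rw [if_neg]
        rintro ⟨_, h⟩
        exact hj (by rw [h])
      · intro h
        simp [hlt] at h
    · intro i _ hi
      refine Finset.sum_eq_zero fun j _ => if_neg ?_
      rintro ⟨_, h⟩
      exact hi (by rw [h])
    · simp
  · intro p hp i j _
    dsimp only
    split_ifs with h h1 h2 h2 <;> try omega
    all_goals
      obtain ⟨-, h3, h4⟩ := hg p hp
      rw [h.2] at h3 h4
      contradiction
  · dsimp only
    simp only [hrow, Finset.sum_boole, Nat.cast_id]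
    calc _ ≤ (Finset.range w.length).card := by
          refine Finset.card_le_card_of_injOn (fun i : Fin N => (i : ℕ)) ?_ ?_
          · intro i hi
            simpa using hi
          · exact Fin.val_injective.injOn
      _ = w.length := Finset.card_range _


/-- Correctness of the ILP for the multihop problem on a nonempty weakly connected
demand set `E` over `n` nodes: with `2n` time slots, binary variables `x^i_v` (the
solution walk is at node `v` at time `i`) and `y^{i,j}_{u,v}` (demand `(u,v)` is
picked up at time `i` and delivered at time `j`), subject to constraints (1)–(3),
a multihop solution of length at most `k` exists iff a feasible assignment with
`Σ x ≤ k + 1` exists. -/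
theorem multihop_ILP_correct {V : Type*} [Fintype V] [DecidableEq V]
    (n : ℕ) (hcard : Fintype.card V = n)
    (E : Finset (V × V)) (hE : ∀ p ∈ E, p.1 ≠ p.2)
    (hne : E.Nonempty) (hconn : WeaklyConnected E) (k : ℕ) :
    (∃ L : List (V × V), IsMultihopSolution L E ∧ L.length ≤ k) ↔
    (∃ (x : Fin (2 * n) → V → ℕ) (y : Fin (2 * n) → Fin (2 * n) → V → V → ℕ),
      (∀ i v, x i v ≤ 1) ∧
      (∀ i j u v, y i j u v ≤ 1) ∧
      (∀ i, ∑ v : V, x i v ≤ 1) ∧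
      (∀ p ∈ E, ∑ i : Fin (2 * n),
        ∑ j ∈ Finset.univ.filter (fun j => i < j), y i j p.1 p.2 = 1) ∧
      (∀ p ∈ E, ∀ i j : Fin (2 * n), i < j → 2 * y i j p.1 p.2 ≤ x i p.1 + x j p.2) ∧
      (∑ i : Fin (2 * n), ∑ v : V, x i v ≤ k + 1)) := by
  subst hcard
  constructor
  · rintro ⟨L, hL, hk⟩
    obtain ⟨w, hw, hwk, hwE⟩ : ∃ w : List V, w.length ≤ 2 * Fintype.card V ∧
        w.length ≤ k + 1 ∧ ∀ p ∈ E, [p.1, p.2].Sublist w := by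
      rcases le_total (2 * Fintype.card V) (k + 1) with h | h
      · have hlen : (Finset.univ.toList ++ Finset.univ.toList : List V).length =
            2 * Fintype.card V := by
          simp [two_mul]
        exact ⟨_, hlen.le, hlen.le.trans h,
          fun p _ => pair_sublist_append (by simp) (by simp)⟩
      · obtain ⟨w, hw, hwE⟩ := hL.exists_word hE hne hconn
        exact ⟨w, by omega, by omega, hwE⟩
    obtain ⟨x, y, h1, h2, h3, h4, h5, h6⟩ := exists_assignment_of_word hw hwE
    exact ⟨x, y, h1, h2, h3, h4, h5, h6.trans hwk⟩
  · rintro ⟨x, y, hx, hy, hrow, hsum, hxy, hk⟩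
    obtain ⟨w, hw, hpair⟩ := exists_word_of_assignment x hrow
    refine ⟨w.zip w.tail, ?_, by simp; omega⟩
    intro p hp
    apply exists_servesPath_of_pair_sublist
    obtain ⟨i, -, hi⟩ := Finset.exists_ne_zero_of_sum_ne_zero
      (ne_of_eq_of_ne (hsum p hp) one_ne_zero)
    obtain ⟨j, hj, hij⟩ := Finset.exists_ne_zero_of_sum_ne_zero hi
    have hlt : i < j := (Finset.mem_filter.1 hj).2
    have h1 := hxy p hp i j hlt
    have h2 := hx i p.1
    have h3 := hx j p.2
    exact hpair i j _ _ hlt (by omega) (by omega)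
end
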